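/- There is a constant M < ∞ depending only on ε such that for all (n,k) ∈ 𝒯, V_off^*(n,k) − V_on^*(n,k) ≤ V_off^*(n,k) − V_on^{br}(n,k) ≤ 2 a_1 M, where br denotes the Budget-Ratio policy. -/

import Mathlib

open MeasureTheory ProbabilityTheory Finset

noncomputable section

namespace MultiSecretary

variable {Ω : Type*}

/-- `Z_j^r`: the number of candidates with ability `aj` among the first `r`
(candidates are indexed `0, 1, …`, so `X 0, …, X (r-1)` are the first `r`). -/
def Zc (X : ℕ → Ω → ℝ) (aj : ℝ) (r : ℕ) (ω : Ω) : ℝ :=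
  ∑ t ∈ range r, if X t ω = aj then 1 else 0

/-- `F̄(a_j) = f_1 + ⋯ + f_{j-1}`. -/
def Fbar (f : ℕ → ℝ) (j : ℕ) : ℝ := ∑ i ∈ Icc 1 (j - 1), f i

/-- The offline-sort count `𝔖_j^r = min { Z_j^r , (k - ∑_{i<j} Z_i^r)_+ }`. -/
def Soff (a : ℕ → ℝ) (X : ℕ → Ω → ℝ) (k r j : ℕ) (ω : Ω) : ℝ :=
  min (Zc X (a j) r ω) (max ((k : ℝ) - ∑ i ∈ Icc 1 (j - 1), Zc X (a i) r ω) 0)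

/-- The offline value `V_off^*(n,k) = ∑_j a_j E[𝔖_j^n]`. -/
def Voff [MeasurableSpace Ω] (μ : Measure Ω) (m : ℕ) (a : ℕ → ℝ) (X : ℕ → Ω → ℝ)
    (n k : ℕ) : ℝ :=
  ∑ j ∈ Icc 1 m, a j * ∫ ω, Soff a X k n j ω ∂μ

/-- The σ-field `𝓕_t` generated by the first `t` pairs `(X_s, U_s)`. -/
def Fil (X U : ℕ → Ω → ℝ) (t : ℕ) : MeasurableSpace Ω :=
  MeasurableSpace.comap (fun ω => fun s : Fin t => (X s ω, U s ω)) inferInstance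

/-- A feasible online policy for the `(n,k)` multi-secretary problem: `σp t` is the
(0/1-valued) decision about candidate `t` (0-indexed), measurable with respect to
`𝓕_{t+1} = σ(X_0,U_0,…,X_t,U_t)`, and at most `k` candidates are selected. -/
def IsPolicy (X U : ℕ → Ω → ℝ) (n k : ℕ) (σp : ℕ → Ω → ℕ) : Prop :=
  (∀ t ω, σp t ω ≤ 1) ∧
  (∀ t, Measurable[Fil X U (t + 1)] (σp t)) ∧
  (∀ ω, ∑ t ∈ range n, σp t ω ≤ k)

/-- The value `V_on^π(n,k)` of an online policy. -/
def Von [MeasurableSpace Ω] (μ : Measure Ω) (X : ℕ → Ω → ℝ) (n : ℕ) (σp : ℕ → Ω → ℕ) : ℝ :=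
  ∫ ω, (∑ t ∈ range n, X t ω * (σp t ω : ℝ)) ∂μ

/-- `V_on^*(n,k)`, the optimal value over feasible online policies. -/
def VonStar [MeasurableSpace Ω] (μ : Measure Ω) (X U : ℕ → Ω → ℝ) (n k : ℕ) : ℝ :=
  sSup {v : ℝ | ∃ σp, IsPolicy X U n k σp ∧ v = Von μ X n σp}

/-- `S_j^{π,r}`: the number of `a_j`-candidates selected by policy `π` among the first `r`. -/
def Spol (a : ℕ → ℝ) (X : ℕ → Ω → ℝ) (σp : ℕ → Ω → ℕ) (j r : ℕ) (ω : Ω) : ℝ :=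
  ∑ t ∈ range r, (σp t ω : ℝ) * (if X t ω = a j then 1 else 0)

/-- The Budget-Ratio thresholds: `T_1 = 0`, `T_j = (F̄(a_j)+F̄(a_{j+1}))/2` for `j ≥ 2`. -/
def Tthr (f : ℕ → ℝ) (j : ℕ) : ℝ := if j = 1 then 0 else (Fbar f j + Fbar f (j + 1)) / 2

/-- The index `j ∈ [m]` with `T_j ≤ x < T_{j+1}` (with `T_{m+1} = ∞`), i.e. the largest
`j ∈ [m]` with `T_j ≤ x`. -/
def jBR (m : ℕ) (f : ℕ → ℝ) (x : ℝ) : ℕ :=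
  ((Icc 1 m).filter fun j => Tthr f j ≤ x).sup id

/-- The remaining-budget process `K_t` of the Budget-Ratio policy: `K_0 = k`, and the
candidate `X_t` (presented at time `t+1`, 1-indexed) is selected iff `K_t > 0` and
`X_t > a_{j+1}` where `T_j ≤ K_t/(n-t) < T_{j+1}` (for `j = m`, i.e. `T_m ≤ K_t/(n-t)`,
every candidate is selected since `T_{m+1} = ∞` and `a_{m+1} < a_m`). -/
def Kbr (m : ℕ) (a f : ℕ → ℝ) (X : ℕ → Ω → ℝ) (n k : ℕ) : ℕ → Ω → ℕ
  | 0, _ => k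
  | t + 1, ω =>
    Kbr m a f X n k t ω -
      (if 0 < Kbr m a f X n k t ω ∧
          (jBR m f ((Kbr m a f X n k t ω : ℝ) / ((n : ℝ) - t)) = m ∨
            a (jBR m f ((Kbr m a f X n k t ω : ℝ) / ((n : ℝ) - t)) + 1) < X t ω)
        then 1 else 0)

/-- The selection decisions `σ^br` of the Budget-Ratio policy (0-indexed candidates). -/
def σbr (m : ℕ) (a f : ℕ → ℝ) (X : ℕ → Ω → ℝ) (n k : ℕ) (t : ℕ) (ω : Ω) : ℕ :=
  Kbr m a f X n k t ω - Kbr m a f X n k (t + 1) ω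

/-- The Bernoulli selection indicators `B_t` of a non-adaptive policy `p = (p_{j,t})`. -/
def Bna (m : ℕ) (a : ℕ → ℝ) (p : ℕ → ℕ → ℝ) (X U : ℕ → Ω → ℝ) (t : ℕ) (ω : Ω) : ℝ :=
  ∑ j ∈ Icc 1 m, if U t ω ≤ p j t ∧ X t ω = a j then 1 else 0

/-- The stopping time `ν = min{ r ≥ 1 : B_1 + ⋯ + B_r ≥ k or r ≥ n }` of a
non-adaptive policy. -/
def nuNA (m : ℕ) (a : ℕ → ℝ) (p : ℕ → ℕ → ℝ) (X U : ℕ → Ω → ℝ) (n k : ℕ) (ω : Ω) : ℕ :=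
  sInf {r : ℕ | 1 ≤ r ∧ ((k : ℝ) ≤ ∑ t ∈ range r, Bna m a p X U t ω ∨ n ≤ r)}

/-- The value `V_on^π(n,k) = ∑_j a_j E[∑_{t ≤ ν} B_t 1(X_t = a_j)]` of a non-adaptive policy. -/
def VonNA [MeasurableSpace Ω] (μ : Measure Ω) (m : ℕ) (a : ℕ → ℝ) (p : ℕ → ℕ → ℝ)
    (X U : ℕ → Ω → ℝ) (n k : ℕ) : ℝ :=
  ∑ j ∈ Icc 1 m, a j *
    ∫ ω, (∑ t ∈ range (nuNA m a p X U n k ω), if X t ω = a j then Bna m a p X U t ω else 0) ∂μ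

/-- `V_na^*(n,k)`: the optimal value over non-adaptive policies. -/
def VnaStar [MeasurableSpace Ω] (μ : Measure Ω) (m : ℕ) (a : ℕ → ℝ) (X U : ℕ → Ω → ℝ)
    (n k : ℕ) : ℝ :=
  sSup {v : ℝ | ∃ p : ℕ → ℕ → ℝ,
    (∀ j t, 0 ≤ p j t ∧ p j t ≤ 1) ∧ v = VonNA μ m a p X U n k}

/-- The deterministic relaxation `DR(n,k)`. -/
def DRval (m : ℕ) (a f : ℕ → ℝ) (n k : ℕ) : ℝ :=
  sSup {v : ℝ | ∃ s : ℕ → ℝ,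
    (∀ j ∈ Icc 1 m, 0 ≤ s j ∧ s j ≤ (n : ℝ) * f j) ∧
    (∑ j ∈ Icc 1 m, s j) ≤ (k : ℝ) ∧ v = ∑ j ∈ Icc 1 m, a j * s j}

/-- The optimal solution `s_j^* = min{ n f_j, (k - n F̄(a_j))_+ }` of the deterministic
relaxation. -/
def sStar (f : ℕ → ℝ) (n k j : ℕ) : ℝ :=
  min ((n : ℝ) * f j) (max ((k : ℝ) - (n : ℝ) * Fbar f j) 0)

/-- `J0Spec m f n k j` says that `j = j₀(n,k)`, the action index of `(n,k)`. -/
def J0Spec (m : ℕ) (f : ℕ → ℝ) (n k j : ℕ) : Prop :=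
  (j = 1 ∧ (k : ℝ) / (n : ℝ) < f 1 + f 2 / 2) ∨
  (1 ≤ j ∧ j + 1 ≤ m ∧ Fbar f j + f j / 2 ≤ (k : ℝ) / (n : ℝ) ∧
    (k : ℝ) / (n : ℝ) < Fbar f (j + 2) - f (j + 1) / 2) ∨
  (j = m ∧ 1 - f m / 2 ≤ (k : ℝ) / (n : ℝ))

/-- The budget ratio `K_t / (n - t)`. -/
def ratio (K : ℕ → Ω → ℕ) (n t : ℕ) (ω : Ω) : ℝ := (K t ω : ℝ) / ((n : ℝ) - t)

/-- The time `τ₀` at which the budget ratio first enters the `δ/2`-orbit of a threshold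
(or the deterministic time `n - 2δ⁻¹ - 1` is reached). -/
def tau0 (m : ℕ) (f : ℕ → ℝ) (δ : ℝ) (K : ℕ → Ω → ℕ) (n : ℕ) (ω : Ω) : ℕ :=
  sInf {t : ℕ |
    (∃ j ∈ Icc 1 m, |ratio K n t ω - Tthr f j| ≤ δ / 2) ∨ (n : ℝ) - 2 / δ - 1 ≤ (t : ℝ)}

/-- The index `j(τ₀)` of the threshold entered at time `τ₀` (set to `m+1`, corresponding to
`T_{j(τ₀)} = ∞`, when `τ₀ ≥ n - 2δ⁻¹ - 1`). -/
def jTau0 (m : ℕ) (f : ℕ → ℝ) (δ : ℝ) (K : ℕ → Ω → ℕ) (n : ℕ) (ω : Ω) : ℕ :=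
  if (tau0 m f δ K n ω : ℝ) < (n : ℝ) - 2 / δ - 1 then
    sInf {j : ℕ | j ∈ Icc 1 m ∧ |ratio K n (tau0 m f δ K n ω) ω - Tthr f j| ≤ δ / 2}
  else m + 1

/-- The exit time `τ = inf{ t > τ₀ : |K_t/(n-t) - T_{j(τ₀)}| > δ or t ≥ n - 2δ⁻¹ - 1 }`
(for `j(τ₀) = m + 1`, i.e. `T_{j(τ₀)} = ∞`, the first condition is vacuous). -/
def tauBR (m : ℕ) (f : ℕ → ℝ) (δ : ℝ) (K : ℕ → Ω → ℕ) (n : ℕ) (ω : Ω) : ℕ :=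
  sInf {t : ℕ | tau0 m f δ K n ω < t ∧
    ((n : ℝ) - 2 / δ - 1 ≤ (t : ℝ) ∨
      (jTau0 m f δ K n ω ≤ m ∧ δ < |ratio K n t ω - Tthr f (jTau0 m f δ K n ω)|))}

/-- The deviation process `Y_u = K_{τ₀+u} - T_{j(τ₀)} (n - τ₀ - u)`. -/
def Ydev (m : ℕ) (f : ℕ → ℝ) (δ : ℝ) (K : ℕ → Ω → ℕ) (n : ℕ) (u : ℕ) (ω : Ω) : ℝ :=
  (K (tau0 m f δ K n ω + u) ω : ℝ) -
    Tthr f (jTau0 m f δ K n ω) * ((n : ℝ) - (tau0 m f δ K n ω : ℝ) - (u : ℝ))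

/-- The minimal mass `min{f_1, …, f_m}` of the ability distribution. -/
def minf (m : ℕ) (f : ℕ → ℝ) : ℝ := sInf {x : ℝ | ∃ j, 1 ≤ j ∧ j ≤ m ∧ x = f j}

/-- The standing model hypotheses of the multi-secretary problem: the abilities
`0 < a_m < ⋯ < a_1`, the probability mass function `f`, and the i.i.d. sequence of
abilities `X_t` together with the auxiliary i.i.d. uniform randomization variables `U_t`. -/
structure Model [MeasurableSpace Ω] (μ : Measure Ω) (m : ℕ) (a f : ℕ → ℝ)
    (X U : ℕ → Ω → ℝ) : Prop where
  hm : 1 ≤ m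
  ha_anti : ∀ j, 1 ≤ j → j < m → a (j + 1) < a j
  ha_pos : 0 < a m
  hf_pos : ∀ j, 1 ≤ j → j ≤ m → 0 < f j
  hf_sum : ∑ j ∈ Icc 1 m, f j = 1
  hprob : IsProbabilityMeasure μ
  hXmeas : ∀ t, Measurable (X t)
  hUmeas : ∀ t, Measurable (U t)
  hXdist : ∀ t j, 1 ≤ j → j ≤ m → μ {ω | X t ω = a j} = ENNReal.ofReal (f j)
  hUdist : ∀ t, μ.map (U t) = volume.restrict (Set.Icc (0 : ℝ) 1)
  hIndep : iIndepFun (fun t ω => (X t ω, U t ω)) μ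
  hXUIndep : ∀ t, IndepFun (X t) (U t) μ

/-- The standing model hypotheses with only the ability sequence `X` (no auxiliary
randomization). -/
structure ModelX [MeasurableSpace Ω] (μ : Measure Ω) (m : ℕ) (a f : ℕ → ℝ)
    (X : ℕ → Ω → ℝ) : Prop where
  hm : 1 ≤ m
  ha_anti : ∀ j, 1 ≤ j → j < m → a (j + 1) < a j
  ha_pos : 0 < a m
  hf_pos : ∀ j, 1 ≤ j → j ≤ m → 0 < f j
  hf_sum : ∑ j ∈ Icc 1 m, f j = 1
  hprob : IsProbabilityMeasure μ
  hXmeas : ∀ t, Measurable (X t)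
  hXdist : ∀ t j, 1 ≤ j → j ≤ m → μ {ω | X t ω = a j} = ENNReal.ofReal (f j)
  hIndep : iIndepFun X μ


/-- Number of `l ≤ j` with `x = a l`, i.e. the indicator that `x` is one of the top `j` abilities. -/
def Pin (a : ℕ → ℝ) (j : ℕ) (x : ℝ) : ℝ := ∑ l ∈ Icc 1 j, if x = a l then 1 else 0

/-- Number of candidates in `[t, n)` among the top `j` abilities. -/
def Ncum (a : ℕ → ℝ) (X : ℕ → Ω → ℝ) (n j t : ℕ) (ω : Ω) : ℝ := ∑ s ∈ Ico t n, Pin a j (X s ω)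

/-- Error indicator bounding the one-step regret. -/
def Err (m : ℕ) (a f : ℕ → ℝ) (X : ℕ → Ω → ℝ) (n t : ℕ) (ω : Ω) : ℝ :=
  ∑ j ∈ Icc 2 m,
    ((if Tthr f j * ((n : ℝ) - t) - 1 ≤ Ncum a X n (j - 1) t ω then 1 else 0) +
     (if Ncum a X n j (t + 1) ω ≤ Tthr f j * ((n : ℝ) - t) then 1 else 0))

lemma a_lt {m : ℕ} {a : ℕ → ℝ} (h : ∀ j, 1 ≤ j → j < m → a (j + 1) < a j) {i j : ℕ}
    (hi : 1 ≤ i) (hij : i < j) (hj : j ≤ m) : a j < a i := by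
  induction j, hij using Nat.le_induction with
  | base => exact h i hi (by omega)
  | succ j hij ih => exact (h j (by omega) (by omega)).trans (ih (by omega))

lemma a_lt_iff {m : ℕ} {a : ℕ → ℝ} (h : ∀ j, 1 ≤ j → j < m → a (j + 1) < a j) {i j : ℕ}
    (hi : 1 ≤ i) (him : i ≤ m) (hj1 : 1 ≤ j) (hj : j ≤ m) : a j < a i ↔ i < j := by
  constructor
  · intro hlt
    by_contra hc
    rcases eq_or_lt_of_le (not_lt.1 hc) with e | e
    · subst e; exact lt_irrefl _ hlt
    · exact lt_asymm hlt (a_lt h hj1 e him)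
  · intro hlt; exact a_lt h hi hlt hj

lemma Pin_a {m : ℕ} {a : ℕ → ℝ} (h : ∀ j, 1 ≤ j → j < m → a (j + 1) < a j) {i j : ℕ}
    (hi : 1 ≤ i) (him : i ≤ m) (hj : j ≤ m) : Pin a j (a i) = if i ≤ j then 1 else 0 := by
  have key : ∀ l ∈ Icc 1 j, (if a i = a l then (1:ℝ) else 0) = if i = l then 1 else 0 := by
    intro l hl
    rw [Finset.mem_Icc] at hl
    by_cases e : i = l
    · simp [e]
    · have : a i ≠ a l := by
        rcases lt_or_gt_of_ne e with e | e
        · exact (a_lt h hi e (by omega)).ne'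
        · exact (a_lt h hl.1 e him).ne
      simp [e, this]
  unfold Pin
  rw [Finset.sum_congr rfl key, Finset.sum_ite_eq]
  simp [hi]

lemma Pin_nonneg (a : ℕ → ℝ) (j : ℕ) (x : ℝ) : 0 ≤ Pin a j x :=
  Finset.sum_nonneg fun _ _ => by split_ifs <;> norm_num

lemma Pin_mono (a : ℕ → ℝ) {i j : ℕ} (hij : i ≤ j) (x : ℝ) : Pin a i x ≤ Pin a j x :=
  Finset.sum_le_sum_of_subset_of_nonneg (Finset.Icc_subset_Icc_right hij)
    fun _ _ _ => by split_ifs <;> norm_num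

lemma Ncum_nonneg (a : ℕ → ℝ) (X : ℕ → Ω → ℝ) (n j t : ℕ) (ω : Ω) : 0 ≤ Ncum a X n j t ω :=
  Finset.sum_nonneg fun _ _ => Pin_nonneg _ _ _

lemma Ncum_mono (a : ℕ → ℝ) (X : ℕ → Ω → ℝ) (n t : ℕ) {i j : ℕ} (hij : i ≤ j) (ω : Ω) :
    Ncum a X n i t ω ≤ Ncum a X n j t ω :=
  Finset.sum_le_sum fun _ _ => Pin_mono _ hij _

lemma Ncum_step (a : ℕ → ℝ) (X : ℕ → Ω → ℝ) {n t : ℕ} (j : ℕ) (ht : t < n) (ω : Ω) :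
    Ncum a X n j t ω = Pin a j (X t ω) + Ncum a X n j (t + 1) ω := by
  unfold Ncum
  rw [Finset.sum_eq_sum_Ico_succ_bot ht]

lemma Err_nonneg (m : ℕ) (a f : ℕ → ℝ) (X : ℕ → Ω → ℝ) (n t : ℕ) (ω : Ω) :
    0 ≤ Err m a f X n t ω :=
  Finset.sum_nonneg fun _ _ => by split_ifs <;> norm_num

lemma Err_one1 {m : ℕ} {a f : ℕ → ℝ} {X : ℕ → Ω → ℝ} {n t : ℕ} {ω : Ω} {j : ℕ} (hj : 2 ≤ j)
    (hjm : j ≤ m) (h : Tthr f j * ((n : ℝ) - t) - 1 ≤ Ncum a X n (j - 1) t ω) :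
    1 ≤ Err m a f X n t ω := by
  refine le_trans ?_ (Finset.single_le_sum (fun _ _ => ?_) (Finset.mem_Icc.2 ⟨hj, hjm⟩))
  · rw [if_pos h]; split_ifs <;> norm_num
  · split_ifs <;> norm_num

lemma Err_one2 {m : ℕ} {a f : ℕ → ℝ} {X : ℕ → Ω → ℝ} {n t : ℕ} {ω : Ω} {j : ℕ} (hj : 2 ≤ j)
    (hjm : j ≤ m) (h : Ncum a X n j (t + 1) ω ≤ Tthr f j * ((n : ℝ) - t)) :
    1 ≤ Err m a f X n t ω := by
  refine le_trans ?_ (Finset.single_le_sum (fun _ _ => ?_) (Finset.mem_Icc.2 ⟨hj, hjm⟩))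
  · rw [if_pos h]; split_ifs <;> norm_num
  · split_ifs <;> norm_num

lemma jBR_spec {m : ℕ} (f : ℕ → ℝ) (hm : 1 ≤ m) {x : ℝ} (hx : 0 ≤ x) :
    1 ≤ jBR m f x ∧ jBR m f x ≤ m ∧ Tthr f (jBR m f x) ≤ x ∧
      (jBR m f x < m → x < Tthr f (jBR m f x + 1)) := by
  have hne : ((Icc 1 m).filter fun j => Tthr f j ≤ x).Nonempty :=
    ⟨1, Finset.mem_filter.2 ⟨Finset.mem_Icc.2 ⟨le_rfl, hm⟩, by simpa [Tthr] using hx⟩⟩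
  obtain ⟨i, hi, e⟩ := Finset.exists_mem_eq_sup _ hne id
  have e' : jBR m f x = i := e
  rw [Finset.mem_filter, Finset.mem_Icc] at hi
  rw [e']
  refine ⟨hi.1.1, hi.1.2, hi.2, fun hlt => ?_⟩
  by_contra hc
  have hmem : i + 1 ∈ (Icc 1 m).filter fun j => Tthr f j ≤ x := by
    rw [Finset.mem_filter, Finset.mem_Icc]
    exact ⟨⟨by omega, by omega⟩, not_lt.1 hc⟩
  have := Finset.le_sup (f := id) hmem
  have h2 : i + 1 ≤ jBR m f x := this
  omega

lemma Kbr_succ_le (m : ℕ) (a f : ℕ → ℝ) (X : ℕ → Ω → ℝ) (n k t : ℕ) (ω : Ω) :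
    Kbr m a f X n k (t + 1) ω ≤ Kbr m a f X n k t ω := by
  rw [Kbr]; exact Nat.sub_le _ _

lemma σbr_le_one (m : ℕ) (a f : ℕ → ℝ) (X : ℕ → Ω → ℝ) (n k t : ℕ) (ω : Ω) :
    σbr m a f X n k t ω ≤ 1 := by
  unfold σbr; rw [Kbr]; split_ifs <;> omega

lemma σbr_sum (m : ℕ) (a f : ℕ → ℝ) (X : ℕ → Ω → ℝ) (n k r : ℕ) (ω : Ω) :
    ∑ t ∈ range r, σbr m a f X n k t ω + Kbr m a f X n k r ω = k := by
  induction r with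
  | zero => simp [Kbr]
  | succ r ih =>
    rw [Finset.sum_range_succ]
    have := Kbr_succ_le m a f X n k r ω
    unfold σbr at *
    omega

lemma step_bound {m : ℕ} {a f : ℕ → ℝ} {X : ℕ → Ω → ℝ} {n k t l : ℕ} {ω : Ω} (hm : 1 ≤ m)
    (h : ∀ j, 1 ≤ j → j < m → a (j + 1) < a j)
    (hX : ∃ i, 1 ≤ i ∧ i ≤ m ∧ X t ω = a i) (ht : t < n) (hl1 : 1 ≤ l) (hl : l ≤ m) :
    min (Kbr m a f X n k t ω : ℝ) (Ncum a X n l t ω) ≤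
      min (Kbr m a f X n k (t + 1) ω : ℝ) (Ncum a X n l (t + 1) ω) +
        (σbr m a f X n k t ω : ℝ) * Pin a l (X t ω) + Err m a f X n t ω := by
  obtain ⟨i, hi1, him, hXi⟩ := hX
  have hE := Err_nonneg m a f X n t ω
  have hN := Ncum_step a X l ht ω
  have hN0 := Ncum_nonneg a X n l (t + 1) ω
  have hP : Pin a l (X t ω) = if i ≤ l then 1 else 0 := by rw [hXi, Pin_a h hi1 him hl]
  rw [hP] at hN ⊢
  unfold σbr
  rw [Kbr]
  set K := Kbr m a f X n k t ω with hK
  have hr : (0:ℝ) < (n : ℝ) - t := by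
    have : (t : ℝ) < n := by exact_mod_cast ht
    linarith
  obtain ⟨hj1, hjm, hT, hT'⟩ := jBR_spec f hm (x := (K : ℝ) / ((n : ℝ) - t)) (by positivity)
  set j := jBR m f ((K : ℝ) / ((n : ℝ) - t)) with hj
  rw [le_div_iff₀ hr] at hT
  rw [div_lt_iff₀ hr] at hT'
  by_cases hK0 : K = 0
  · simp only [hK0, lt_irrefl, false_and, if_false]
    simp only [Nat.sub_self, Nat.cast_zero, zero_mul]
    rw [min_eq_left hN0]
    have := min_le_left (0:ℝ) (Ncum a X n l t ω)
    linarith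
  have hKpos : 0 < K := Nat.pos_of_ne_zero hK0
  by_cases hacc : j = m ∨ a (j + 1) < X t ω
  · rw [if_pos ⟨hKpos, hacc⟩]
    have hsub : K - (K - 1) = 1 := by omega
    rw [hsub, Nat.cast_sub hKpos, Nat.cast_one]
    by_cases hil : i ≤ l
    · rw [if_pos hil] at hN ⊢
      rw [hN, show (K : ℝ) = ((K : ℝ) - 1) + 1 by ring, add_comm (1:ℝ), min_add_add_right]
      simp only [add_sub_cancel_right]
      linarith
    · rw [if_neg hil] at hN ⊢
      have hij : i ≤ j := by
        rcases hacc with e | e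
        · omega
        · by_cases hjm' : j = m
          · omega
          · rw [hXi, a_lt_iff h hi1 him (by omega) (by omega)] at e
            omega
      rw [zero_add] at hN
      rw [← hN, mul_zero, add_zero]
      by_cases hc : Ncum a X n l t ω ≤ (K : ℝ) - 1
      · rw [min_eq_right hc, min_eq_right (by linarith)]; linarith
      · push Not at hc
        have : 1 ≤ Err m a f X n t ω := by
          refine Err_one1 (j := j) (by omega) hjm ?_
          have := Ncum_mono a X n t (show l ≤ j - 1 by omega) ω
          linarith
        have h1 := min_le_left (K : ℝ) (Ncum a X n l t ω)
        rw [min_eq_left hc.le]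
        linarith
  · rw [if_neg (fun hh => hacc hh.2)]
    push Not at hacc
    obtain ⟨hjm', hacc⟩ := hacc
    have hjlt : j < m := lt_of_le_of_ne hjm hjm'
    have hij : j + 1 ≤ i := by
      by_contra hc
      rw [hXi] at hacc
      exact absurd (a_lt h hi1 (show i < j + 1 by omega) hjlt) (not_lt.2 hacc)
    simp only [Nat.sub_zero, Nat.sub_self, Nat.cast_zero, zero_mul, add_zero]
    by_cases hil : i ≤ l
    · rw [if_pos hil] at hN
      by_cases hc : (K : ℝ) ≤ Ncum a X n l (t + 1) ω
      · rw [min_eq_left hc]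
        have h1 := min_le_left (K : ℝ) (Ncum a X n l t ω)
        linarith
      · push Not at hc
        have : 1 ≤ Err m a f X n t ω := by
          refine Err_one2 (j := j + 1) (by omega) hjlt ?_
          have := Ncum_mono a X n (t + 1) (show j + 1 ≤ l by omega) ω
          linarith [hT' hjlt]
        have h1 := min_le_right (K : ℝ) (Ncum a X n l t ω)
        rw [min_eq_right hc.le]
        linarith
    · rw [if_neg hil, zero_add] at hN
      rw [hN]; linarith

lemma path_l {m : ℕ} {a f : ℕ → ℝ} {X : ℕ → Ω → ℝ} {n k l : ℕ} {ω : Ω} (hm : 1 ≤ m)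
    (h : ∀ j, 1 ≤ j → j < m → a (j + 1) < a j)
    (hX : ∀ t, ∃ i, 1 ≤ i ∧ i ≤ m ∧ X t ω = a i) (hl1 : 1 ≤ l) (hl : l ≤ m) :
    min (k : ℝ) (Ncum a X n l 0 ω) ≤
      ∑ t ∈ range n, (σbr m a f X n k t ω : ℝ) * Pin a l (X t ω) +
        ∑ t ∈ range n, Err m a f X n t ω := by
  have key : ∀ r, r ≤ n → min (k : ℝ) (Ncum a X n l 0 ω) ≤
      min (Kbr m a f X n k r ω : ℝ) (Ncum a X n l r ω) +
      ∑ t ∈ range r, (σbr m a f X n k t ω : ℝ) * Pin a l (X t ω) +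
        ∑ t ∈ range r, Err m a f X n t ω := by
    intro r
    induction r with
    | zero => intro _; simp [Kbr]
    | succ r ih =>
      intro hr
      rw [Finset.sum_range_succ, Finset.sum_range_succ]
      have := step_bound (f := f) (k := k) hm h (hX r) (show r < n by omega) hl1 hl
      linarith [ih (by omega)]
  have h1 := key n le_rfl
  have h2 : Ncum a X n l n ω = 0 := by simp [Ncum]
  rw [h2] at h1
  have h3 := min_le_right (Kbr m a f X n k n ω : ℝ) 0
  linarith

lemma abel (b G : ℕ → ℝ) (hG : G 0 = 0) (M : ℕ) :
    ∑ j ∈ Icc 1 M, b j * (G j - G (j - 1)) =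
      ∑ l ∈ Icc 1 M, (b l - b (l + 1)) * G l + b (M + 1) * G M := by
  induction M with
  | zero => simp [hG]
  | succ M ih =>
    rw [Finset.sum_Icc_succ_top (by omega), Finset.sum_Icc_succ_top (by omega), ih]
    simp only [Nat.add_sub_cancel]
    ring

/-- `a` cut off to zero above `m`. -/
def cut (m : ℕ) (a : ℕ → ℝ) (j : ℕ) : ℝ := if j ≤ m then a j else 0

lemma abel_cut (m : ℕ) (a G : ℕ → ℝ) (hG : G 0 = 0) :
    ∑ j ∈ Icc 1 m, a j * (G j - G (j - 1)) =
      ∑ l ∈ Icc 1 m, (cut m a l - cut m a (l + 1)) * G l := by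
  have := abel (cut m a) G hG m
  rw [show cut m a (m + 1) = 0 by simp [cut], zero_mul, add_zero] at this
  rw [← this]
  refine Finset.sum_congr rfl fun j hj => ?_
  rw [Finset.mem_Icc] at hj
  simp [cut, hj.2]

lemma Pin_sub (a : ℕ → ℝ) {j : ℕ} (hj : 1 ≤ j) (x : ℝ) :
    Pin a j x - Pin a (j - 1) x = if x = a j then 1 else 0 := by
  obtain ⟨j, rfl⟩ : ∃ i, j = i + 1 := ⟨j - 1, by omega⟩
  unfold Pin
  rw [Finset.sum_Icc_succ_top (by omega)]
  simp

lemma Soff_eq (a : ℕ → ℝ) (X : ℕ → Ω → ℝ) (k n : ℕ) {j : ℕ} (hj : 1 ≤ j) (ω : Ω) :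
    Soff a X k n j ω = min (k : ℝ) (Ncum a X n j 0 ω) - min (k : ℝ) (Ncum a X n (j - 1) 0 ω) := by
  have h1 : ∑ i ∈ Icc 1 (j - 1), Zc X (a i) n ω = Ncum a X n (j - 1) 0 ω := by
    unfold Zc Ncum Pin
    rw [Finset.sum_comm, Finset.range_eq_Ico]
  have h2 : Zc X (a j) n ω = Ncum a X n j 0 ω - Ncum a X n (j - 1) 0 ω := by
    unfold Zc Ncum
    rw [← Finset.sum_sub_distrib, Finset.range_eq_Ico]
    exact Finset.sum_congr rfl fun s _ => (Pin_sub a hj _).symm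
  have h3 := Ncum_mono a X n 0 (show j - 1 ≤ j by omega) ω
  unfold Soff
  rw [h1, h2]
  rcases le_total (k : ℝ) (Ncum a X n (j - 1) 0 ω) with hc | hc
  · rw [max_eq_right (by linarith), min_eq_right (by linarith), min_eq_left (by linarith),
      min_eq_left hc, sub_self]
  · rw [max_eq_left (by linarith), min_eq_right hc]
    rcases le_total (k : ℝ) (Ncum a X n j 0 ω) with hd | hd
    · rw [min_eq_left hd, min_eq_right (by linarith)]
    · rw [min_eq_right hd, min_eq_left (by linarith)]

lemma path_bound {m : ℕ} {a f : ℕ → ℝ} {X : ℕ → Ω → ℝ} {n k : ℕ} {ω : Ω} (hm : 1 ≤ m)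
    (h : ∀ j, 1 ≤ j → j < m → a (j + 1) < a j) (ham : 0 < a m)
    (hX : ∀ t, ∃ i, 1 ≤ i ∧ i ≤ m ∧ X t ω = a i) :
    ∑ j ∈ Icc 1 m, a j * Soff a X k n j ω -
      ∑ t ∈ range n, X t ω * (σbr m a f X n k t ω : ℝ) ≤
        a 1 * ∑ t ∈ range n, Err m a f X n t ω := by
  have hoff : ∑ j ∈ Icc 1 m, a j * Soff a X k n j ω =
      ∑ l ∈ Icc 1 m, (cut m a l - cut m a (l + 1)) * min (k : ℝ) (Ncum a X n l 0 ω) := by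
    rw [← abel_cut m a (fun l => min (k : ℝ) (Ncum a X n l 0 ω)) (by simp [Ncum, Pin])]
    refine Finset.sum_congr rfl fun j hj => ?_
    rw [Finset.mem_Icc] at hj
    rw [Soff_eq _ _ _ _ hj.1]
  have hon : ∑ t ∈ range n, X t ω * (σbr m a f X n k t ω : ℝ) =
      ∑ l ∈ Icc 1 m, (cut m a l - cut m a (l + 1)) *
        ∑ t ∈ range n, (σbr m a f X n k t ω : ℝ) * Pin a l (X t ω) := by
    rw [← abel_cut m a (fun l => ∑ t ∈ range n, (σbr m a f X n k t ω : ℝ) * Pin a l (X t ω))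
      (by simp [Pin])]
    have : ∀ j ∈ Icc 1 m, a j * (∑ t ∈ range n, (σbr m a f X n k t ω : ℝ) * Pin a j (X t ω) -
        ∑ t ∈ range n, (σbr m a f X n k t ω : ℝ) * Pin a (j - 1) (X t ω)) =
        ∑ t ∈ range n, a j * ((σbr m a f X n k t ω : ℝ) * if X t ω = a j then 1 else 0) := by
      intro j hj
      rw [Finset.mem_Icc] at hj
      rw [← Finset.sum_sub_distrib, Finset.mul_sum]
      refine Finset.sum_congr rfl fun t _ => ?_
      rw [← mul_sub, Pin_sub a hj.1]
    rw [Finset.sum_congr rfl this, Finset.sum_comm]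
    refine Finset.sum_congr rfl fun t _ => ?_
    obtain ⟨i, hi1, him, hXi⟩ := hX t
    have h1 : ∑ j ∈ Icc 1 m, (if X t ω = a j then (1:ℝ) else 0) = 1 := by
      have := Pin_a h hi1 him le_rfl
      rw [if_pos him, ← hXi] at this
      exact this
    calc X t ω * (σbr m a f X n k t ω : ℝ)
        = X t ω * (σbr m a f X n k t ω : ℝ) *
            ∑ j ∈ Icc 1 m, (if X t ω = a j then (1:ℝ) else 0) := by rw [h1, mul_one]
      _ = _ := by
        rw [Finset.mul_sum]
        refine Finset.sum_congr rfl fun j _ => ?_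
        split_ifs with hh
        · rw [hh]; ring
        · simp
  have hd : ∀ l ∈ Icc 1 m, 0 ≤ cut m a l - cut m a (l + 1) := by
    intro l hl
    rw [Finset.mem_Icc] at hl
    unfold cut
    rw [if_pos hl.2]
    split_ifs with hh
    · linarith [h l hl.1 hh]
    · have : l = m := by omega
      subst this; linarith
  have hsum : ∑ l ∈ Icc 1 m, (cut m a l - cut m a (l + 1)) = a 1 := by
    have := abel_cut m a (fun l => if 1 ≤ l then 1 else 0) (by simp)
    have e2 : ∑ l ∈ Icc 1 m, (cut m a l - cut m a (l + 1)) =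
        ∑ l ∈ Icc 1 m, (cut m a l - cut m a (l + 1)) * (if 1 ≤ l then 1 else 0) := by
      refine Finset.sum_congr rfl fun j hj => ?_
      rw [Finset.mem_Icc] at hj
      simp [hj.1]
    rw [e2, ← this, Finset.sum_eq_single 1]
    · simp
    · intro j hj hne
      rw [Finset.mem_Icc] at hj
      rw [if_pos hj.1, if_pos (by omega)]; simp
    · intro hh; exact absurd (Finset.mem_Icc.2 ⟨le_rfl, hm⟩) hh
  rw [hoff, hon, ← hsum, Finset.sum_mul, ← Finset.sum_sub_distrib]
  refine Finset.sum_le_sum fun l hl => ?_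
  rw [← mul_sub]
  refine mul_le_mul_of_nonneg_left ?_ (hd l hl)
  rw [Finset.mem_Icc] at hl
  have := path_l (f := f) (n := n) (k := k) hm h hX hl.1 hl.2
  linarith

section prob

variable [MeasurableSpace Ω] {μ : Measure Ω} {m : ℕ} {a f : ℕ → ℝ} {X U : ℕ → Ω → ℝ}

lemma Pin_meas (a : ℕ → ℝ) (j : ℕ) : Measurable (Pin a j) := by
  unfold Pin
  refine Finset.measurable_fun_sum _ fun l _ => ?_
  exact Measurable.ite (measurableSet_eq_fun measurable_id measurable_const)
    measurable_const measurable_const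

lemma Ncum_meas (hX : ∀ t, Measurable (X t)) (a : ℕ → ℝ) (n j t : ℕ) :
    Measurable (Ncum a X n j t) := by
  unfold Ncum
  exact Finset.measurable_fun_sum _ fun s _ => (Pin_meas a j).comp (hX s)

lemma X_int_ind (H : Model μ m a f X U) (t : ℕ) {j : ℕ} (hj1 : 1 ≤ j) (hj : j ≤ m) :
    Integrable (fun ω => if X t ω = a j then (1:ℝ) else 0) μ ∧
      ∫ ω, (if X t ω = a j then (1:ℝ) else 0) ∂μ = f j := by
  have := H.hprob
  have hs : MeasurableSet {ω | X t ω = a j} :=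
    measurableSet_eq_fun (H.hXmeas t) measurable_const
  have e : (fun ω => if X t ω = a j then (1:ℝ) else 0) =
      Set.indicator {ω | X t ω = a j} (fun _ => (1:ℝ)) := by
    ext ω; simp [Set.indicator]
  rw [e]
  refine ⟨(integrable_const _).indicator hs, ?_⟩
  rw [integral_indicator_const _ hs, Measure.real, H.hXdist t j hj1 hj,
    ENNReal.toReal_ofReal (H.hf_pos j hj1 hj).le]
  simp

lemma Pin_integral (H : Model μ m a f X U) (t : ℕ) {j : ℕ} (hj : j ≤ m) :
    ∫ ω, Pin a j (X t ω) ∂μ = Fbar f (j + 1) := by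
  unfold Pin Fbar
  rw [integral_finsetSum]
  · refine Finset.sum_congr rfl fun l hl => ?_
    rw [Finset.mem_Icc] at hl
    exact (X_int_ind H t hl.1 (hl.2.trans hj)).2
  · intro l hl
    rw [Finset.mem_Icc] at hl
    exact (X_int_ind H t hl.1 (hl.2.trans hj)).1

lemma X_support (H : Model μ m a f X U) :
    ∀ᵐ ω ∂μ, ∀ t, ∃ i, 1 ≤ i ∧ i ≤ m ∧ X t ω = a i := by
  have := H.hprob
  rw [ae_all_iff]
  intro t
  have hs : MeasurableSet (⋃ i ∈ Icc 1 m, {ω | X t ω = a i}) :=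
    Finset.measurableSet_biUnion _ fun i _ =>
      measurableSet_eq_fun (H.hXmeas t) measurable_const
  have h1 : μ (⋃ i ∈ Icc 1 m, {ω | X t ω = a i}) = 1 := by
    rw [measure_biUnion_finset]
    · have : ∀ i ∈ Icc 1 m, μ {ω | X t ω = a i} = ENNReal.ofReal (f i) := by
        intro i hi
        rw [Finset.mem_Icc] at hi
        exact H.hXdist t i hi.1 hi.2
      rw [Finset.sum_congr rfl this, ← ENNReal.ofReal_sum_of_nonneg, H.hf_sum, ENNReal.ofReal_one]
      intro i hi
      rw [Finset.mem_Icc] at hi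
      exact (H.hf_pos i hi.1 hi.2).le
    · intro i hi j hj hne
      have hi' := Finset.mem_Icc.1 (Finset.mem_coe.1 hi)
      have hj' := Finset.mem_Icc.1 (Finset.mem_coe.1 hj)
      refine Set.disjoint_left.2 fun ω h1 h2 => ?_
      have h3 : a i = a j := (h1 : X t ω = a i).symm.trans h2
      rcases lt_or_gt_of_ne hne with e | e
      · exact (a_lt H.ha_anti hi'.1 e hj'.2).ne' h3
      · exact (a_lt H.ha_anti hj'.1 e hi'.2).ne h3
    · intro i _
      exact measurableSet_eq_fun (H.hXmeas t) measurable_const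
  have h2 := (prob_compl_eq_zero_iff hs).2 h1
  rw [ae_iff]
  refine measure_mono_null ?_ h2
  intro ω hω
  simp only [Set.mem_compl_iff, Set.mem_iUnion, Finset.mem_Icc, Set.mem_ofPred_eq, not_exists] at hω ⊢
  intro i hi hx
  exact hω i ⟨hi.1, hi.2, hx⟩

lemma hoeff_arith {ε d r c : ℝ} (hε : 0 < ε) (hr : 1 ≤ r) (hc0 : 0 ≤ c) (hc : c ≤ r / 4)
    (hd : ε * r - 1 ≤ d) (hd0 : 0 ≤ ε * r - 1) :
    Real.exp (-d ^ 2 / (2 * c)) ≤ 1 ∧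
    (0 < c → Real.exp (-d ^ 2 / (2 * c)) ≤ Real.exp (4 * ε) * Real.exp (-2 * ε ^ 2) ^ r) := by
  constructor
  · rw [Real.exp_le_one_iff]
    exact div_nonpos_of_nonpos_of_nonneg (by nlinarith [sq_nonneg d]) (by linarith)
  · intro hcp
    rw [← Real.exp_mul, ← Real.exp_add, Real.exp_le_exp, div_le_iff₀ (by linarith)]
    have h1 : (ε * r - 1) ^ 2 ≤ d ^ 2 := by nlinarith
    have h2 : 2 * ε ^ 2 * r - 4 * ε ≤ 2 * (ε * r - 1) ^ 2 / r := by
      rw [le_div_iff₀ (by linarith)]; nlinarith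
    have h3 : 2 * (ε * r - 1) ^ 2 / r * (2 * c) ≤ (ε * r - 1) ^ 2 := by
      rw [div_mul_eq_mul_div, div_le_iff₀ (by linarith)]
      nlinarith [sq_nonneg (ε * r - 1)]
    nlinarith

/-- Tail bound for centered sums of `[0,1]`-valued independent variables. -/
lemma hoeff [IsProbabilityMeasure μ] {Y : ℕ → Ω → ℝ} (hind : iIndepFun Y μ)
    (hsub : ∀ s, HasSubgaussianMGF (Y s) (1 / 4) μ) {ε : ℝ} (hε : 0 < ε) (t' t n : ℕ)
    (htt : t ≤ t') (ht : t < n) (d : ℝ) (hd : ε * ((n : ℝ) - t) - 1 ≤ d) :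
    μ.real {ω | d ≤ ∑ s ∈ Ico t' n, Y s ω} ≤
      Real.exp (4 * ε) * Real.exp (-2 * ε ^ 2) ^ (n - t) := by
  have hr : (1:ℝ) ≤ (n : ℝ) - t := by
    have : (t : ℝ) + 1 ≤ n := by exact_mod_cast ht
    linarith
  have hcast : ((n - t : ℕ) : ℝ) = (n : ℝ) - t := by rw [Nat.cast_sub ht.le]
  rw [← Real.rpow_natCast, hcast]
  have hrhs : Real.exp (4 * ε) * Real.exp (-2 * ε ^ 2) ^ ((n : ℝ) - t) =
      Real.exp (2 * ε * (2 - ε * ((n : ℝ) - t))) := by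
    rw [← Real.exp_mul, ← Real.exp_add]; congr 1; ring
  by_cases hneg : ε * ((n : ℝ) - t) - 1 ≤ 1
  · refine le_trans measureReal_le_one ?_
    rw [hrhs]
    exact Real.one_le_exp (mul_nonneg (by linarith) (by linarith))
  · push Not at hneg
    have hb := HasSubgaussianMGF.measure_sum_ge_le_of_iIndepFun (s := Ico t' n) hind
      (c := fun _ => 1 / 4) (fun i _ => hsub i) (show 0 ≤ d by linarith)
    by_cases htn : t' < n
    · refine hb.trans ((hoeff_arith hε hr ?_ ?_ hd (by linarith)).2 ?_)
      · positivity
      · simp only [Finset.sum_const, Nat.card_Ico]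
        rw [nsmul_eq_mul, NNReal.coe_mul, NNReal.coe_natCast, Nat.cast_sub htn.le]
        have : (t : ℝ) ≤ t' := by exact_mod_cast htt
        push_cast
        linarith
      · simp only [Finset.sum_const, Nat.card_Ico]
        rw [nsmul_eq_mul, NNReal.coe_mul, NNReal.coe_natCast, Nat.cast_sub htn.le]
        have : (t' : ℝ) < n := by exact_mod_cast htn
        push_cast
        linarith
    · have : {ω | d ≤ ∑ s ∈ Ico t' n, Y s ω} = ∅ := by
        ext ω
        rw [Finset.Ico_eq_empty htn]
        simp
        linarith
      rw [this, measureReal_empty]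
      positivity

lemma Pin_subG (H : Model μ m a f X U) {j : ℕ} (hj : j ≤ m) (s : ℕ) :
    HasSubgaussianMGF (fun ω => Pin a j (X s ω) - Fbar f (j + 1)) (1 / 4) μ := by
  have := H.hprob
  have := hasSubgaussianMGF_of_mem_Icc (μ := μ) (X := fun ω => Pin a j (X s ω)) (a := 0) (b := 1)
    ((Pin_meas a j).comp (H.hXmeas s)).aemeasurable (by
      filter_upwards [X_support H] with ω hω
      obtain ⟨i, hi1, him, hXi⟩ := hω s
      rw [hXi, Pin_a H.ha_anti hi1 him hj]
      split_ifs <;> simp)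
  rw [Pin_integral H s hj] at this
  convert this using 1
  norm_num

lemma Pin_indep (H : Model μ m a f X U) (g : ℝ → ℝ) (hg : Measurable g) :
    iIndepFun (fun s ω => g (X s ω)) μ :=
  H.hIndep.comp (fun _ p => g p.1) fun _ => hg.comp measurable_fst

lemma minf_le (H : Model μ m a f X U) {j : ℕ} (hj1 : 1 ≤ j) (hj : j ≤ m) : minf m f ≤ f j := by
  refine csInf_le ⟨0, ?_⟩ ⟨j, hj1, hj, rfl⟩
  rintro x ⟨i, h1, h2, rfl⟩
  exact (H.hf_pos i h1 h2).le

lemma Fbar_succ (f : ℕ → ℝ) {j : ℕ} (hj : 1 ≤ j) : Fbar f (j + 1) = Fbar f j + f j := by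
  obtain ⟨j, rfl⟩ : ∃ i, j = i + 1 := ⟨j - 1, by omega⟩
  unfold Fbar
  simp only [Nat.add_sub_cancel]
  rw [Finset.sum_Icc_succ_top (by omega)]

lemma Fbar_le_one (H : Model μ m a f X U) {j : ℕ} (hj : j ≤ m) : Fbar f (j + 1) ≤ 1 := by
  rw [← H.hf_sum]
  refine Finset.sum_le_sum_of_subset_of_nonneg (Finset.Icc_subset_Icc_right (by omega)) ?_
  intro i hi _
  rw [Finset.mem_Icc] at hi
  exact (H.hf_pos i hi.1 hi.2).le

lemma prob1 (H : Model μ m a f X U) {ε : ℝ} (hε : 0 < ε) (he : ε = minf m f / 2) {j n t : ℕ}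
    (hj2 : 2 ≤ j) (hj : j ≤ m) (ht : t < n) :
    μ.real {ω | Tthr f j * ((n : ℝ) - t) - 1 ≤ Ncum a X n (j - 1) t ω} ≤
      Real.exp (4 * ε) * Real.exp (-2 * ε ^ 2) ^ (n - t) := by
  have := H.hprob
  have hf := minf_le H (show 1 ≤ j by omega) hj
  have hr : (0:ℝ) < (n : ℝ) - t := by
    have : (t : ℝ) < n := by exact_mod_cast ht
    linarith
  have hF := Fbar_succ f (show 1 ≤ j by omega)
  have hT : Tthr f j = Fbar f j + f j / 2 := by
    unfold Tthr; rw [if_neg (by omega), hF]; ring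
  have e : j - 1 + 1 = j := by omega
  have hb := hoeff (Pin_indep H (fun x => Pin a (j - 1) x - Fbar f (j - 1 + 1))
    ((Pin_meas a _).sub_const _)) (fun s => Pin_subG H (show j - 1 ≤ m by omega) s) hε t t n le_rfl ht
    (f j / 2 * ((n : ℝ) - t) - 1) (by nlinarith)
  refine le_trans (le_of_eq ?_) hb
  congr 1
  ext ω
  simp only [Set.mem_ofPred_eq, Finset.sum_sub_distrib, Finset.sum_const, Nat.card_Ico, e]
  rw [nsmul_eq_mul, Nat.cast_sub ht.le, hT, Ncum]
  constructor <;> intro hh <;> nlinarith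

lemma prob2 (H : Model μ m a f X U) {ε : ℝ} (hε : 0 < ε) (he : ε = minf m f / 2) {j n t : ℕ}
    (hj2 : 2 ≤ j) (hj : j ≤ m) (ht : t < n) :
    μ.real {ω | Ncum a X n j (t + 1) ω ≤ Tthr f j * ((n : ℝ) - t)} ≤
      Real.exp (4 * ε) * Real.exp (-2 * ε ^ 2) ^ (n - t) := by
  have := H.hprob
  have hf := minf_le H (show 1 ≤ j by omega) hj
  have hr : (0:ℝ) < (n : ℝ) - t := by
    have : (t : ℝ) < n := by exact_mod_cast ht
    linarith
  have hF := Fbar_succ f (show 1 ≤ j by omega)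
  have hT : Tthr f j = Fbar f (j + 1) - f j / 2 := by
    unfold Tthr; rw [if_neg (by omega), hF]; ring
  have hF1 := Fbar_le_one H hj
  have hb := hoeff (Pin_indep H (fun x => -(Pin a j x - Fbar f (j + 1)))
    ((Pin_meas a _).sub_const _).neg) (fun s => (Pin_subG H hj s).neg) hε (t + 1) t n
    (Nat.le_succ t) ht
    (f j / 2 * ((n : ℝ) - t) - Fbar f (j + 1)) (by nlinarith)
  refine le_trans (le_of_eq ?_) hb
  congr 1
  ext ω
  simp only [Set.mem_ofPred_eq, Finset.sum_sub_distrib, Finset.sum_neg_distrib, Finset.sum_const,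
    Nat.card_Ico]
  rw [nsmul_eq_mul, Nat.cast_sub (show t + 1 ≤ n by omega), hT, Ncum]
  push_cast
  constructor <;> intro hh <;> nlinarith

lemma Err_int (H : Model μ m a f X U) {ε : ℝ} (hε : 0 < ε) (he : ε = minf m f / 2) {n t : ℕ}
    (ht : t < n) :
    Integrable (Err m a f X n t) μ ∧ ∫ ω, Err m a f X n t ω ∂μ ≤
      (m : ℝ) * (2 * (Real.exp (4 * ε) * Real.exp (-2 * ε ^ 2) ^ (n - t))) := by
  have := H.hprob
  have gen : ∀ (S : Set Ω) [DecidablePred (· ∈ S)], MeasurableSet S →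
      Integrable (fun ω => if ω ∈ S then (1:ℝ) else 0) μ ∧
      ∫ ω, (if ω ∈ S then (1:ℝ) else 0) ∂μ = μ.real S := by
    intro S _ hS
    have e : (fun ω => if ω ∈ S then (1:ℝ) else 0) = Set.indicator S (fun _ => (1:ℝ)) := by
      ext ω; simp [Set.indicator]
    rw [e]
    exact ⟨(integrable_const _).indicator hS, by rw [integral_indicator_const _ hS]; simp⟩
  have g1 : ∀ j, Integrable (fun ω => if Tthr f j * ((n : ℝ) - t) - 1 ≤ Ncum a X n (j - 1) t ω
      then (1:ℝ) else 0) μ ∧ ∫ ω, (if Tthr f j * ((n : ℝ) - t) - 1 ≤ Ncum a X n (j - 1) t ω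
      then (1:ℝ) else 0) ∂μ = μ.real {ω | Tthr f j * ((n : ℝ) - t) - 1 ≤ Ncum a X n (j - 1) t ω} :=
    fun j => gen {ω | Tthr f j * ((n : ℝ) - t) - 1 ≤ Ncum a X n (j - 1) t ω}
      (measurableSet_le measurable_const (Ncum_meas H.hXmeas _ _ _ _))
  have g2 : ∀ j, Integrable (fun ω => if Ncum a X n j (t + 1) ω ≤ Tthr f j * ((n : ℝ) - t)
      then (1:ℝ) else 0) μ ∧ ∫ ω, (if Ncum a X n j (t + 1) ω ≤ Tthr f j * ((n : ℝ) - t)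
      then (1:ℝ) else 0) ∂μ = μ.real {ω | Ncum a X n j (t + 1) ω ≤ Tthr f j * ((n : ℝ) - t)} :=
    fun j => gen {ω | Ncum a X n j (t + 1) ω ≤ Tthr f j * ((n : ℝ) - t)}
      (measurableSet_le (Ncum_meas H.hXmeas _ _ _ _) measurable_const)
  refine ⟨integrable_finsetSum _ fun j _ => (g1 j).1.add (g2 j).1, ?_⟩
  unfold Err
  rw [integral_finsetSum _ fun j _ => Integrable.fun_add (g1 j).1 (g2 j).1]
  set q := Real.exp (4 * ε) * Real.exp (-2 * ε ^ 2) ^ (n - t) with hq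
  have hq0 : 0 ≤ q := by positivity
  calc _ ≤ ∑ j ∈ Icc 2 m, 2 * q := by
        refine Finset.sum_le_sum fun j hj => ?_
        rw [Finset.mem_Icc] at hj
        rw [integral_add (g1 j).1 (g2 j).1, (g1 j).2, (g2 j).2]
        linarith [prob1 H hε he hj.1 hj.2 ht, prob2 H hε he hj.1 hj.2 ht]
    _ ≤ (m : ℝ) * (2 * q) := by
        rw [Finset.sum_const, nsmul_eq_mul, Nat.card_Icc]
        refine mul_le_mul_of_nonneg_right ?_ (by linarith)
        exact_mod_cast (by omega)

lemma Kbr_meas (X U : ℕ → Ω → ℝ) (m : ℕ) (a f : ℕ → ℝ) (n k t : ℕ) :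
    Measurable[Fil X U t] (Kbr m a f X n k t) := by
  induction t with
  | zero => exact @measurable_const _ _ _ (Fil X U 0) k
  | succ t ih =>
    have hle : Fil X U t ≤ Fil X U (t + 1) := by
      unfold Fil
      have : (fun ω => fun s : Fin t => (X s ω, U s ω)) =
          (fun (g : Fin (t + 1) → ℝ × ℝ) (s : Fin t) => g s.castSucc) ∘
            (fun ω => fun s : Fin (t + 1) => (X s ω, U s ω)) := by
        ext ω s <;> simp
      rw [this, ← MeasurableSpace.comap_comp]
      refine MeasurableSpace.comap_mono (Measurable.comap_le ?_)
      exact measurable_pi_lambda _ fun s => measurable_pi_apply _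
    have hX : Measurable[Fil X U (t + 1)] (X t) := by
      have h1 : Measurable[Fil X U (t + 1)]
          (fun ω => fun s : Fin (t + 1) => (X s ω, U s ω)) := comap_measurable _
      have h2 : Measurable (fun g : Fin (t + 1) → ℝ × ℝ => (g (Fin.last t)).1) :=
        measurable_fst.comp (measurable_pi_apply _)
      exact h2.comp h1
    have hK : Measurable[Fil X U (t + 1)] (Kbr m a f X n k t) := ih.mono hle le_rfl
    have hp : Measurable[Fil X U (t + 1)] (fun ω => (X t ω, Kbr m a f X n k t ω)) :=
      hX.prodMk hK
    have hg : Measurable (fun p : ℝ × ℕ => p.2 -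
      (if 0 < p.2 ∧
          (jBR m f ((p.2 : ℝ) / ((n : ℝ) - t)) = m ∨
            a (jBR m f ((p.2 : ℝ) / ((n : ℝ) - t)) + 1) < p.1)
        then 1 else 0)) := by
      refine measurable_from_prod_countable_left fun K => ?_
      refine Measurable.const_sub ?_ K
      refine Measurable.ite ?_ measurable_const measurable_const
      by_cases h1 : 0 < K
      · by_cases h2 : jBR m f ((K : ℝ) / ((n : ℝ) - t)) = m
        · simp only [h1, h2, true_or, and_self]
          exact MeasurableSet.const _
        · simp only [h1, h2, false_or, true_and]
          exact measurableSet_lt measurable_const measurable_id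
      · simp only [h1, false_and]
        exact MeasurableSet.const _
    exact hg.comp hp

lemma Fil_mono (X U : ℕ → Ω → ℝ) (t : ℕ) : Fil X U t ≤ Fil X U (t + 1) := by
  unfold Fil
  have : (fun ω => fun s : Fin t => (X s ω, U s ω)) =
      (fun (g : Fin (t + 1) → ℝ × ℝ) (s : Fin t) => g s.castSucc) ∘
        (fun ω => fun s : Fin (t + 1) => (X s ω, U s ω)) := by
    ext ω s <;> simp
  rw [this, ← MeasurableSpace.comap_comp]
  refine MeasurableSpace.comap_mono (Measurable.comap_le ?_)
  exact measurable_pi_lambda _ fun s => measurable_pi_apply _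

lemma Fil_le (H : Model μ m a f X U) (t : ℕ) : Fil X U t ≤ ‹MeasurableSpace Ω› :=
  Measurable.comap_le (measurable_pi_lambda _ fun s => (H.hXmeas s).prodMk (H.hUmeas s))

lemma σbr_meas (X U : ℕ → Ω → ℝ) (m : ℕ) (a f : ℕ → ℝ) (n k t : ℕ) :
    Measurable[Fil X U (t + 1)] (σbr m a f X n k t) := by
  have h1 := (Kbr_meas X U m a f n k t).mono (Fil_mono X U t) le_rfl
  have h2 := Kbr_meas X U m a f n k (t + 1)
  exact h1.sub h2

lemma br_policy (X U : ℕ → Ω → ℝ) (m : ℕ) (a f : ℕ → ℝ) (n k : ℕ) :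
    IsPolicy X U n k (σbr m a f X n k) :=
  ⟨fun t ω => σbr_le_one m a f X n k t ω, σbr_meas X U m a f n k,
    fun ω => by have := σbr_sum m a f X n k n ω; omega⟩

lemma X_bound (H : Model μ m a f X U) :
    ∀ᵐ ω ∂μ, ∀ t, 0 ≤ X t ω ∧ X t ω ≤ a 1 := by
  filter_upwards [X_support H] with ω hω t
  obtain ⟨i, hi1, him, hXi⟩ := hω t
  rw [hXi]
  constructor
  · rcases eq_or_lt_of_le him with e | e
    · rw [e]; exact H.ha_pos.le
    · exact (H.ha_pos.trans (a_lt H.ha_anti hi1 e le_rfl)).le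
  · rcases eq_or_lt_of_le hi1 with e | e
    · rw [← e]
    · exact (a_lt H.ha_anti le_rfl e him).le

lemma Von_le_star (H : Model μ m a f X U) (n k : ℕ) :
    Von μ X n (σbr m a f X n k) ≤ VonStar μ X U n k := by
  have := H.hprob
  refine le_csSup ⟨(n : ℝ) * a 1, ?_⟩ ⟨_, br_policy X U m a f n k, rfl⟩
  rintro v ⟨σp, hσ, rfl⟩
  have : ∫ ω, (∑ t ∈ range n, X t ω * (σp t ω : ℝ)) ∂μ ≤ ∫ _ω, (n : ℝ) * a 1 ∂μ := by
    refine integral_mono_of_nonneg ?_ (integrable_const _) ?_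
    · filter_upwards [X_bound H] with ω hω
      exact Finset.sum_nonneg fun t _ => mul_nonneg (hω t).1 (Nat.cast_nonneg _)
    · filter_upwards [X_bound H] with ω hω
      calc ∑ t ∈ range n, X t ω * (σp t ω : ℝ) ≤ ∑ t ∈ range n, a 1 := by
            refine Finset.sum_le_sum fun t _ => ?_
            have h1 : (σp t ω : ℝ) ≤ 1 := by exact_mod_cast hσ.1 t ω
            nlinarith [hω t]
        _ = (n : ℝ) * a 1 := by simp
  simpa [Von] using this

lemma Soff_int (H : Model μ m a f X U) (k n : ℕ) {j : ℕ} (hj : 1 ≤ j) :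
    Integrable (Soff a X k n j) μ := by
  have := H.hprob
  have e : Soff a X k n j = fun ω => min (k : ℝ) (Ncum a X n j 0 ω) -
      min (k : ℝ) (Ncum a X n (j - 1) 0 ω) := by
    ext ω; exact Soff_eq a X k n hj ω
  have g : ∀ i, Integrable (fun ω => min (k : ℝ) (Ncum a X n i 0 ω)) μ := by
    intro i
    refine Integrable.of_mem_Icc 0 (k : ℝ)
      (measurable_const.min (Ncum_meas H.hXmeas _ _ _ _)).aemeasurable ?_
    refine Filter.Eventually.of_forall fun ω => ⟨?_, min_le_left _ _⟩
    exact le_min (Nat.cast_nonneg _) (Ncum_nonneg _ _ _ _ _ _)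
  rw [e]
  exact (g j).sub (g (j - 1))

lemma on_int (H : Model μ m a f X U) (k n : ℕ) :
    Integrable (fun ω => ∑ t ∈ range n, X t ω * (σbr m a f X n k t ω : ℝ)) μ := by
  have := H.hprob
  refine integrable_finsetSum _ fun t _ => ?_
  have hσ : Measurable (σbr m a f X n k t) := (σbr_meas X U m a f n k t).mono (Fil_le H _) le_rfl
  refine Integrable.of_mem_Icc 0 (a 1)
    ((H.hXmeas t).mul (measurable_from_nat.comp hσ)).aemeasurable ?_
  filter_upwards [X_bound H] with ω hω
  have h1 : (σbr m a f X n k t ω : ℝ) ≤ 1 := by exact_mod_cast σbr_le_one m a f X n k t ω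
  have h0 : (0:ℝ) ≤ (σbr m a f X n k t ω : ℝ) := Nat.cast_nonneg _
  exact ⟨mul_nonneg (hω t).1 h0, by nlinarith [hω t]⟩

lemma regret_bound (H : Model μ m a f X U) {ε : ℝ} (hε : 0 < ε) (he : ε = minf m f / 2) (n k : ℕ) :
    Voff μ m a X n k - Von μ X n (σbr m a f X n k) ≤
      2 * a 1 * (1 / (2 * ε) * (Real.exp (4 * ε) * (1 - Real.exp (-2 * ε ^ 2))⁻¹)) := by
  have := H.hprob
  have ha1 : 0 ≤ a 1 := by
    obtain ⟨ω, hω⟩ := (X_bound H).exists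
    exact (hω 0).1.trans (hω 0).2
  have e1 : Voff μ m a X n k = ∫ ω, ∑ j ∈ Icc 1 m, a j * Soff a X k n j ω ∂μ := by
    rw [integral_finsetSum]
    · unfold Voff
      refine Finset.sum_congr rfl fun j _ => ?_
      rw [integral_const_mul]
    · intro j hj
      exact (Soff_int H k n (Finset.mem_Icc.1 hj).1).const_mul _
  have i1 : Integrable (fun ω => ∑ j ∈ Icc 1 m, a j * Soff a X k n j ω) μ :=
    integrable_finsetSum _ fun j hj => (Soff_int H k n (Finset.mem_Icc.1 hj).1).const_mul _
  have i2 : ∀ t ∈ range n, Integrable (Err m a f X n t) μ := fun t ht =>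
    (Err_int H hε he (Finset.mem_range.1 ht)).1
  have hρ0 : 0 < Real.exp (-2 * ε ^ 2) := Real.exp_pos _
  have hρ1 : Real.exp (-2 * ε ^ 2) < 1 := by
    rw [Real.exp_lt_one_iff]; nlinarith [sq_pos_of_pos hε]
  set ρ := Real.exp (-2 * ε ^ 2) with hρ
  have hgeom : ∑ t ∈ range n, ρ ^ (n - t) ≤ (1 - ρ)⁻¹ := by
    have h1 : ∑ t ∈ range n, ρ ^ (n - t) ≤ ∑ t ∈ range (n + 1), ρ ^ (n - t) :=
      Finset.sum_le_sum_of_subset_of_nonneg (by simp) fun _ _ _ => by positivity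
    have h2 : ∑ t ∈ range (n + 1), ρ ^ (n - t) = ∑ t ∈ range (n + 1), ρ ^ t := by
      have := Finset.sum_range_reflect (fun t => ρ ^ t) (n + 1)
      simpa using this
    rw [h2] at h1
    refine h1.trans ?_
    rw [← tsum_geometric_of_lt_one hρ0.le hρ1]
    exact (summable_geometric_of_lt_one hρ0.le hρ1).sum_le_tsum _ fun _ _ => by positivity
  have hm : (m : ℝ) * (2 * ε) ≤ 1 := by
    rw [← H.hf_sum]
    have : ∑ j ∈ Icc 1 m, (2 * ε) ≤ ∑ j ∈ Icc 1 m, f j := by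
      refine Finset.sum_le_sum fun j hj => ?_
      rw [Finset.mem_Icc] at hj
      linarith [minf_le H hj.1 hj.2]
    simpa using this
  have hm' : (m : ℝ) ≤ 1 / (2 * ε) := by rw [le_div_iff₀ (by linarith)]; exact hm
  calc Voff μ m a X n k - Von μ X n (σbr m a f X n k)
      = ∫ ω, (∑ j ∈ Icc 1 m, a j * Soff a X k n j ω -
          ∑ t ∈ range n, X t ω * (σbr m a f X n k t ω : ℝ)) ∂μ := by
        rw [e1, Von, integral_sub i1 (on_int H k n)]
    _ ≤ ∫ ω, a 1 * ∑ t ∈ range n, Err m a f X n t ω ∂μ := by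
        refine integral_mono_ae (i1.sub (on_int H k n))
          ((integrable_finsetSum _ i2).const_mul _) ?_
        filter_upwards [X_support H] with ω hω
        exact path_bound H.hm H.ha_anti H.ha_pos hω
    _ = a 1 * ∑ t ∈ range n, ∫ ω, Err m a f X n t ω ∂μ := by
        rw [integral_const_mul, integral_finsetSum _ i2]
    _ ≤ a 1 * ∑ t ∈ range n, (m : ℝ) * (2 * (Real.exp (4 * ε) * ρ ^ (n - t))) := by
        refine mul_le_mul_of_nonneg_left ?_ ha1
        exact Finset.sum_le_sum fun t ht => (Err_int H hε he (Finset.mem_range.1 ht)).2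
    _ = 2 * a 1 * ((m : ℝ) * (Real.exp (4 * ε) * ∑ t ∈ range n, ρ ^ (n - t))) := by
        rw [Finset.mul_sum, Finset.mul_sum, Finset.mul_sum, Finset.mul_sum]
        exact Finset.sum_congr rfl fun t _ => by ring
    _ ≤ _ := by
        refine mul_le_mul_of_nonneg_left ?_ (by linarith)
        refine mul_le_mul hm' ?_ (by positivity) (by positivity)
        exact mul_le_mul_of_nonneg_left hgeom (Real.exp_pos _).le

end prob

/-- Corollary 1, uniformly bounded regret: there is a constant
`M ≡ M(ε)` such that for all `(n,k) ∈ 𝒯`,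
`V_off^*(n,k) - V_on^*(n,k) ≤ V_off^*(n,k) - V_on^br(n,k) ≤ 2 a_1 M`. -/
theorem budget_ratio_bounded_regret (ε : ℝ) (hε0 : 0 < ε) :
    ∃ M : ℝ,
      ∀ (Ω : Type) [MeasurableSpace Ω] (μ : Measure Ω)
        (m : ℕ) (a f : ℕ → ℝ) (X U : ℕ → Ω → ℝ),
        Model μ m a f X U → ε = minf m f / 2 →
        ∀ n k : ℕ, k ≤ n →
          (Voff μ m a X n k - VonStar μ X U n k ≤
              Voff μ m a X n k - Von μ X n (σbr m a f X n k)) ∧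
            Voff μ m a X n k - Von μ X n (σbr m a f X n k) ≤ 2 * a 1 * M := by
  refine ⟨1 / (2 * ε) * (Real.exp (4 * ε) * (1 - Real.exp (-2 * ε ^ 2))⁻¹), ?_⟩
  intro Ω _ μ m a f X U H he n k _
  exact ⟨sub_le_sub_left (Von_le_star H n k) _, regret_bound H hε0 he n k⟩

end MultiSecretary
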